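/- arXiv:1807.00034 — 2 statements merged into one kernel-verified Lean document; each statement's English description precedes it below -/
import Mathlib

section
/- Let 0 < α < β. Then the exceptional zero x̂_{n,n}^{(α,β)} of the X₁-Jacobi polynomial P̂_n^{(α,β)} satisfies x̂_{1,1}^{(α,β)} = c, and the sequence of exceptional zeros is strictly decreasing and bounded below by b; that is, b < x̂_{n+1,n+1}^{(α,β)} < x̂_{n,n}^{(α,β)} for every n ≥ 1, and hence b < … < x̂_{n,n}^{(α,β)} < … < x̂_{2,2}^{(α,β)} < x̂_{1,1}^{(α,β)} = c. -/
open Finset Filter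

/-- The Jacobi polynomial `P_n^{(α,β)}(x)` via its explicit sum representation. -/
noncomputable def jacobiP (α β : ℝ) (n : ℕ) (x : ℝ) : ℝ :=
  ∑ s ∈ Finset.range (n + 1),
    ((∏ j ∈ Finset.Icc (s + 1) n, (α + (j : ℝ))) / (Nat.factorial (n - s) : ℝ)) *
      ((∏ j ∈ Finset.Icc (n - s + 1) n, (β + (j : ℝ))) / (Nat.factorial s : ℝ)) *
      ((x - 1) / 2) ^ s * ((x + 1) / 2) ^ (n - s)

/-- The X₁-Jacobi polynomial `P̂_n^{(α,β)}(x)` for `n ≥ 1`, with `b = (β+α)/(β-α)`. -/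
noncomputable def X1jacobiP (α β : ℝ) (n : ℕ) (x : ℝ) : ℝ :=
  -(1 / 2) * (x - (β + α) / (β - α)) * jacobiP α β (n - 1) x +
    ((β + α) / (β - α) * jacobiP α β (n - 1) x -
        (if 2 ≤ n then jacobiP α β (n - 2) x else 0)) / (2 * (n : ℝ) - 2 + α + β)

/-- The generalized Laguerre polynomial `L_n^{(α)}(x)` via its explicit sum representation. -/
noncomputable def laguerreL (α : ℝ) (n : ℕ) (x : ℝ) : ℝ :=
  ∑ k ∈ Finset.range (n + 1),
    (-1 : ℝ) ^ k / (Nat.factorial k : ℝ) *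
      ((∏ j ∈ Finset.Icc (k + 1) n, (α + (j : ℝ))) / (Nat.factorial (n - k) : ℝ)) * x ^ k

/-- The X₁-Laguerre polynomial `L̂_n^{(α)}(x)` for `n ≥ 1`. -/
noncomputable def X1laguerreL (α : ℝ) (n : ℕ) (x : ℝ) : ℝ :=
  -(x + α + 1) * laguerreL α (n - 1) x + (if 2 ≤ n then laguerreL α (n - 2) x else 0)

/-- The physicist's Hermite polynomial `H_m(x)`. -/
noncomputable def hermiteH (m : ℕ) (x : ℝ) : ℝ :=
  (Nat.factorial m : ℝ) *
    ∑ j ∈ Finset.range (m / 2 + 1),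
      (-1 : ℝ) ^ j / ((Nat.factorial j : ℝ) * (Nat.factorial (m - 2 * j) : ℝ)) *
        (2 * x) ^ (m - 2 * j)

/-- `z 1 < z 2 < … < z n` enumerates, in increasing order, all real zeros of `f`. -/
def EnumZeros (f : ℝ → ℝ) (n : ℕ) (z : ℕ → ℝ) : Prop :=
  StrictMonoOn z (Set.Icc 1 n) ∧ ∀ x : ℝ, f x = 0 ↔ ∃ k, 1 ≤ k ∧ k ≤ n ∧ x = z k

/-- The weighted convolution sum `∑_{k+l=m} h(k,l) u^k v^l / ((α+1)_k k! (β+1)_l l!)`. -/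
noncomputable def jacobiConv (α β u v : ℝ) (h : ℝ → ℝ → ℝ) (m : ℕ) : ℝ :=
  ∑ p ∈ Finset.HasAntidiagonal.antidiagonal m, h p.1 p.2 *
    (((∏ j ∈ Finset.range p.1, (α + (j + 1 : ℝ))) * (Nat.factorial p.1 : ℝ))⁻¹ *
      ((∏ j ∈ Finset.range p.2, (β + (j + 1 : ℝ))) * (Nat.factorial p.2 : ℝ))⁻¹ *
      u ^ p.1 * v ^ p.2)

lemma prod_range_add_pos {α : ℝ} (hα : 0 < α) (n : ℕ) :
    0 < ∏ j ∈ Finset.range n, (α + (j + 1 : ℝ)) :=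
  Finset.prod_pos fun j _ => by positivity

lemma left_mul_jacobiConv {α : ℝ} (β u v : ℝ) (hα : 0 < α) (h : ℝ → ℝ → ℝ) (m : ℕ) :
    u * jacobiConv α β u v h m =
      jacobiConv α β u v (fun k l => k * (k + α) * h (k - 1) l) (m + 1) := by
  unfold jacobiConv
  rw [Finset.Nat.sum_antidiagonal_succ, Finset.mul_sum]
  simp only [Nat.cast_zero, zero_mul, zero_add]
  refine Finset.sum_congr rfl fun p _ => ?_
  have h1 := (prod_range_add_pos hα p.1).ne'
  have h2 : (Nat.factorial p.1 : ℝ) ≠ 0 := by positivity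
  have h3 : (p.1 : ℝ) + 1 ≠ 0 := by positivity
  have h4 : α + ((p.1 : ℝ) + 1) ≠ 0 := by positivity
  rw [Finset.prod_range_succ, Nat.factorial_succ]
  push_cast
  rw [add_sub_cancel_right]
  simp only [mul_inv]
  field_simp
  ring

lemma right_mul_jacobiConv (α : ℝ) {β : ℝ} (u v : ℝ) (hβ : 0 < β) (h : ℝ → ℝ → ℝ) (m : ℕ) :
    v * jacobiConv α β u v h m =
      jacobiConv α β u v (fun k l => l * (l + β) * h k (l - 1)) (m + 1) := by
  unfold jacobiConv
  rw [Finset.Nat.sum_antidiagonal_succ', Finset.mul_sum]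
  simp only [Nat.cast_zero, zero_mul, zero_add]
  refine Finset.sum_congr rfl fun p _ => ?_
  have h1 := (prod_range_add_pos hβ p.2).ne'
  have h2 : (Nat.factorial p.2 : ℝ) ≠ 0 := by positivity
  have h3 : (p.2 : ℝ) + 1 ≠ 0 := by positivity
  have h4 : β + ((p.2 : ℝ) + 1) ≠ 0 := by positivity
  rw [Finset.prod_range_succ, Nat.factorial_succ]
  push_cast
  rw [add_sub_cancel_right]
  simp only [mul_inv]
  field_simp
  ring

lemma prod_Icc_eq_div {α : ℝ} (hα : 0 < α) {k n : ℕ} (h : k ≤ n) :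
    ∏ j ∈ Finset.Icc (k + 1) n, (α + (j : ℝ)) =
      (∏ j ∈ Finset.range n, (α + (j + 1 : ℝ))) / ∏ j ∈ Finset.range k, (α + (j + 1 : ℝ)) := by
  induction n, h using Nat.le_induction with
  | base => simp [div_self (prod_range_add_pos hα k).ne']
  | succ n hn ih =>
    rw [Finset.prod_Icc_succ_top (by omega), ih, Finset.prod_range_succ]
    push_cast
    ring

lemma jacobiP_eq_jacobiConv {α β : ℝ} (hα : 0 < α) (hβ : 0 < β) (n : ℕ) (x : ℝ) :
    jacobiP α β n x =
      (∏ j ∈ Finset.range n, (α + (j + 1 : ℝ))) * (∏ j ∈ Finset.range n, (β + (j + 1 : ℝ))) *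
        jacobiConv α β ((x - 1) / 2) ((x + 1) / 2) (fun _ _ => 1) n := by
  unfold jacobiP jacobiConv
  rw [Finset.Nat.sum_antidiagonal_eq_sum_range_succ_mk, Finset.mul_sum]
  refine Finset.sum_congr rfl fun k hk => ?_
  have hk' : k ≤ n := Nat.lt_succ_iff.mp (Finset.mem_range.mp hk)
  rw [prod_Icc_eq_div hα hk', prod_Icc_eq_div hβ (Nat.sub_le n k)]
  simp only [mul_inv, div_eq_mul_inv]
  ring

lemma jacobiP_zero (α β x : ℝ) : jacobiP α β 0 x = 1 := by
  simp [jacobiP]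

lemma jacobiP_one (α β x : ℝ) :
    jacobiP α β 1 x = ((α + β + 2) * x - (β - α)) / 2 := by
  simp [jacobiP, Finset.sum_range_succ]
  ring

lemma jacobiP_pos {α β x : ℝ} (hα : 0 < α) (hβ : 0 < β) (hx : 1 ≤ x) (n : ℕ) :
    0 < jacobiP α β n x := by
  have hx' : 0 ≤ (x - 1) / 2 := by linarith
  have hx'' : 0 < (x + 1) / 2 := by linarith
  have hprod {γ : ℝ} (hγ : 0 < γ) (s : Finset ℕ) : 0 < ∏ j ∈ s, (γ + (j : ℝ)) :=
    Finset.prod_pos fun j _ => by positivity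
  refine Finset.sum_pos' (fun s _ => ?_) ⟨0, by simp, ?_⟩
  · have := hprod hα (Finset.Icc (s + 1) n)
    have := hprod hβ (Finset.Icc (n - s + 1) n)
    positivity
  · have := hprod hα (Finset.Icc (0 + 1) n)
    have := hprod hβ (Finset.Icc (n - 0 + 1) n)
    rw [pow_zero]
    positivity

lemma continuous_jacobiP (α β : ℝ) (n : ℕ) : Continuous (jacobiP α β n) := by
  unfold jacobiP
  fun_prop

/-- The three-term recurrence of the Jacobi polynomials. -/
lemma jacobiP_add_two {α β : ℝ} (hα : 0 < α) (hβ : 0 < β) (m : ℕ) (x : ℝ) :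
    2 * ((m : ℝ) + 2) * (m + 2 + α + β) * (2 * m + 2 + α + β) * jacobiP α β (m + 2) x =
      (2 * m + 3 + α + β) * ((2 * m + 2 + α + β) * (2 * m + 4 + α + β) * x
        - (α + β) * (β - α)) * jacobiP α β (m + 1) x
      - 2 * (m + 1 + α) * (m + 1 + β) * (2 * m + 4 + α + β) * jacobiP α β m x := by
  simp only [jacobiP_eq_jacobiConv hα hβ, Finset.prod_range_succ]
  set u := (x - 1) / 2 with hu
  set v := (x + 1) / 2 with hv
  set A := ∏ j ∈ Finset.range m, (α + (j + 1 : ℝ))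
  set B := ∏ j ∈ Finset.range m, (β + (j + 1 : ℝ))
  have key : 2 * ((m : ℝ) + 2) * (m + 2 + α + β) * (2 * m + 2 + α + β) * (α + (m + 2))
        * (β + (m + 2)) * jacobiConv α β u v (fun _ _ => 1) (m + 2) =
      (2 * m + 3 + α + β) * (((2 * m + 2 + α + β) * (2 * m + 4 + α + β) + (α + β) * (β - α))
          * (u * jacobiConv α β u v (fun _ _ => 1) (m + 1))
        + ((2 * m + 2 + α + β) * (2 * m + 4 + α + β) - (α + β) * (β - α))
          * (v * jacobiConv α β u v (fun _ _ => 1) (m + 1)))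
      - 2 * (2 * m + 4 + α + β) * (u * (u * jacobiConv α β u v (fun _ _ => 1) m)
        - 2 * (u * (v * jacobiConv α β u v (fun _ _ => 1) m))
        + v * (v * jacobiConv α β u v (fun _ _ => 1) m)) := by
    simp only [left_mul_jacobiConv β u v hα, right_mul_jacobiConv α u v hβ]
    simp only [jacobiConv, Finset.mul_sum, ← Finset.sum_add_distrib, ← Finset.sum_sub_distrib]
    refine Finset.sum_congr rfl fun p hp => ?_
    have hm : (m : ℝ) = p.1 + p.2 - 2 := by
      have : p.1 + p.2 = m + 1 + 1 := Finset.HasAntidiagonal.mem_antidiagonal.mp hp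
      have : (p.1 : ℝ) + p.2 = m + 1 + 1 := by exact_mod_cast this
      linarith
    rw [hm]
    generalize (_ * _ * u ^ p.1 * v ^ p.2 : ℝ) = t
    ring
  have hx : x = u + v := by rw [hu, hv]; ring
  have huv : v = u + 1 := by rw [hu, hv]; ring
  rw [hx]
  push_cast
  rw [huv] at key ⊢
  linear_combination A * B * (α + (m + 1)) * (β + (m + 1)) * key

/-- The positive multiple `-(2μ + α + β) P̂_{μ+1}` of the negated X₁-Jacobi polynomial. -/
noncomputable def negX1 (α β : ℝ) (μ : ℕ) (x : ℝ) : ℝ :=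
  -(2 * μ + α + β) * X1jacobiP α β (μ + 1) x

lemma negX1_zero {α β : ℝ} (hα : 0 < α) (hβ : 0 < β) (x : ℝ) :
    negX1 α β 0 x =
      (α + β) * (x - (β + α) / (β - α)) / 2 - (β + α) / (β - α) := by
  have : α + β ≠ 0 := by positivity
  simp [negX1, X1jacobiP, jacobiP_zero]
  field_simp
  ring

lemma negX1_succ {α β : ℝ} (hα : 0 < α) (hβ : 0 < β) (μ : ℕ) (x : ℝ) :
    negX1 α β (μ + 1) x =
      ((2 * μ + 2 + α + β) * (x - (β + α) / (β - α)) / 2 - (β + α) / (β - α))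
        * jacobiP α β (μ + 1) x + jacobiP α β μ x := by
  have : 2 * (μ : ℝ) + 2 + α + β ≠ 0 := by positivity
  simp only [negX1, X1jacobiP, Nat.add_sub_cancel, show μ + 1 + 1 - 2 = μ by omega,
    show 2 ≤ μ + 1 + 1 by omega, if_true]
  push_cast
  rw [show 2 * ((μ : ℝ) + 1 + 1) - 2 + α + β = 2 * μ + 2 + α + β by ring,
    show 2 * ((μ : ℝ) + 1) + α + β = 2 * μ + 2 + α + β by ring]
  field_simp
  ring

lemma negX1_recurrence {α β : ℝ} (hα : 0 < α) (hαβ : α < β) (μ : ℕ) (x : ℝ) :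
    (2 * μ + α + β) * ((2 * μ + 2 + α + β) ^ 2 - (β - α) ^ 2) *
        ((β + α) / (β - α) + (2 * μ + 2 + α + β) * (x - (β + α) / (β - α)) / 2)
        * negX1 α β (μ + 1) x =
      (2 * μ + α + β) * (2 * μ + 2 + α + β) ^ 2 *
        (((2 * μ + 2 + α + β) ^ 2 - (β - α) ^ 2) * ((x - (β + α) / (β - α)) / 2) ^ 2
          - 4 * α * β / (β - α) ^ 2) * jacobiP α β (μ + 1) x
      + ((2 * μ + α + β) ^ 2 - (β - α) ^ 2) * (2 * μ + 2 + α + β) * negX1 α β μ x := by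
  have hβ : 0 < β := hα.trans hαβ
  have hd : β - α ≠ 0 := (sub_pos.mpr hαβ).ne'
  obtain ⟨y, rfl⟩ : ∃ y, x = (β + α) / (β - α) + y := ⟨x - (β + α) / (β - α), by ring⟩
  rw [negX1_succ hα hβ]
  cases μ with
  | zero =>
    rw [negX1_zero hα hβ, jacobiP_zero, zero_add, jacobiP_one]
    field_simp
    push_cast
    ring
  | succ m =>
    rw [negX1_succ hα hβ]
    have h := jacobiP_add_two hα hβ m ((β + α) / (β - α) + y)
    generalize jacobiP α β (m + 1 + 1) ((β + α) / (β - α) + y) = P2 at *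
    generalize jacobiP α β (m + 1) ((β + α) / (β - α) + y) = P1 at *
    generalize jacobiP α β m ((β + α) / (β - α) + y) = P0 at *
    have hab : 4 * α * β / (β - α) ^ 2 = ((β + α) / (β - α)) ^ 2 - 1 := by
      field_simp
      ring
    rw [hab]
    have hs : β + α = (β + α) / (β - α) * (β - α) := by field_simp
    generalize (β + α) / (β - α) = b at *
    obtain ⟨d, rfl⟩ : ∃ d, β = α + d := ⟨β - α, by ring⟩
    rw [add_sub_cancel_left] at *
    obtain rfl : α = d * (b - 1) / 2 := by linarith
    push_cast
    linear_combination (-2) * h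

lemma sq_diff_pos {α β : ℝ} (hα : 0 < α) (hβ : 0 < β) (μ : ℕ) :
    0 < (2 * (μ : ℝ) + α + β) ^ 2 - (β - α) ^ 2 := by
  have : (2 * (μ : ℝ) + α + β) ^ 2 - (β - α) ^ 2 = 4 * (μ + α) * (μ + β) := by ring
  rw [this]
  positivity

lemma one_lt_of_lt {α β x : ℝ} (hα : 0 < α) (hαβ : α < β) (hx : (β + α) / (β - α) < x) :
    1 < x := by
  refine lt_trans ?_ hx
  rw [one_lt_div (sub_pos.mpr hαβ)]
  linarith

/-- Up to the threshold `((x - b) / 2)² = 4αβ / ((β-α)² ((2μ+α+β)² - (β-α)²))`,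
the polynomial `negX1` stays nonpositive to the right of `b`. -/
lemma negX1_nonpos {α β x : ℝ} (hα : 0 < α) (hαβ : α < β) (hx : (β + α) / (β - α) < x)
    (μ : ℕ) (h : ((2 * (μ : ℝ) + α + β) ^ 2 - (β - α) ^ 2) * ((x - (β + α) / (β - α)) / 2) ^ 2
      ≤ 4 * α * β / (β - α) ^ 2) : negX1 α β μ x ≤ 0 := by
  have hβ : 0 < β := hα.trans hαβ
  have hd : 0 < β - α := sub_pos.mpr hαβ
  have hy : 0 < x - (β + α) / (β - α) := sub_pos.mpr hx
  induction μ with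
  | zero =>
    rw [negX1_zero hα hβ]
    generalize x - (β + α) / (β - α) = y at *
    rw [le_div_iff₀ (by positivity)] at h
    push_cast at h
    have h1 : (α * β) * (y * (β - α)) ^ 2 ≤ (α * β) * 2 ^ 2 := by linarith
    have h2 : y * (β - α) ≤ 2 := by
      have := le_of_mul_le_mul_left h1 (by positivity)
      exact (pow_le_pow_iff_left₀ (by positivity) (by norm_num) (by norm_num)).mp this
    rw [sub_nonpos, le_div_iff₀ hd]
    nlinarith
  | succ μ ih =>
    have hrec := negX1_recurrence hα hαβ μ x
    have hP := jacobiP_pos hα hβ (one_lt_of_lt hα hαβ hx).le (μ + 1)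
    have hM := sq_diff_pos hα hβ μ
    have hN := sq_diff_pos hα hβ (μ + 1)
    push_cast at h hN
    rw [show 2 * ((μ : ℝ) + 1) + α + β = 2 * μ + 2 + α + β by ring] at h hN
    have hmono : ((2 * (μ : ℝ) + α + β) ^ 2 - (β - α) ^ 2) ≤
        (2 * μ + 2 + α + β) ^ 2 - (β - α) ^ 2 := by
      gcongr ?_ ^ 2 - _
      linarith
    have ih' := ih (le_trans (by gcongr) h)
    have hb : 0 < (β + α) / (β - α) := by positivity
    refine nonpos_of_mul_nonpos_right (a := (2 * (μ : ℝ) + α + β) *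
      ((2 * μ + 2 + α + β) ^ 2 - (β - α) ^ 2) * ((β + α) / (β - α) +
        (2 * μ + 2 + α + β) * (x - (β + α) / (β - α)) / 2)) ?_ (by positivity)
    rw [hrec]
    refine add_nonpos (mul_nonpos_of_nonpos_of_nonneg ?_ hP.le) ?_
    · exact mul_nonpos_of_nonneg_of_nonpos (by positivity) (sub_nonpos.mpr h)
    · exact mul_nonpos_of_nonneg_of_nonpos (by positivity) ih'

lemma negX1_succ_pos {α β x : ℝ} (hα : 0 < α) (hαβ : α < β) (hx : (β + α) / (β - α) < x)
    (μ : ℕ) (h : 4 * α * β / (β - α) ^ 2 ≤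
      ((2 * (μ : ℝ) + α + β) ^ 2 - (β - α) ^ 2) * ((x - (β + α) / (β - α)) / 2) ^ 2)
    (hμ : 0 ≤ negX1 α β μ x) : 0 < negX1 α β (μ + 1) x := by
  have hβ : 0 < β := hα.trans hαβ
  have hd : 0 < β - α := sub_pos.mpr hαβ
  have hy : 0 < x - (β + α) / (β - α) := sub_pos.mpr hx
  have hP := jacobiP_pos hα hβ (one_lt_of_lt hα hαβ hx).le (μ + 1)
  have hM := sq_diff_pos hα hβ μ
  have hb : 0 < (β + α) / (β - α) := by positivity
  have hmono : ((2 * (μ : ℝ) + α + β) ^ 2 - (β - α) ^ 2) <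
      (2 * μ + 2 + α + β) ^ 2 - (β - α) ^ 2 := by
    gcongr ?_ ^ 2 - _
    linarith
  have hN := hM.trans hmono
  have h' : 4 * α * β / (β - α) ^ 2 <
      ((2 * (μ : ℝ) + 2 + α + β) ^ 2 - (β - α) ^ 2) * ((x - (β + α) / (β - α)) / 2) ^ 2 :=
    h.trans_lt (by gcongr)
  refine pos_of_mul_pos_right (a := (2 * (μ : ℝ) + α + β) *
    ((2 * μ + 2 + α + β) ^ 2 - (β - α) ^ 2) * ((β + α) / (β - α) +
      (2 * μ + 2 + α + β) * (x - (β + α) / (β - α)) / 2)) ?_ (by positivity)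
  rw [negX1_recurrence hα hαβ μ x]
  have := sub_pos.mpr h'
  positivity

lemma negX1_eventually_pos {α β : ℝ} (hα : 0 < α) (hαβ : α < β) (μ : ℕ) (x : ℝ) :
    ∃ t, x ≤ t ∧ 0 < negX1 α β μ t := by
  have hβ : 0 < β := hα.trans hαβ
  have hd : 0 < β - α := sub_pos.mpr hαβ
  have hb : 0 < (β + α) / (β - α) := by positivity
  set b := (β + α) / (β - α) with hbdef
  set y := max (x - b) (2 * (b + 1) / (α + β)) with hy
  have hy1 : x - b ≤ y := le_max_left _ _
  have hy2 : 2 * (b + 1) ≤ (α + β) * y := by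
    have : 2 * (b + 1) / (α + β) ≤ y := le_max_right _ _
    rwa [div_le_iff₀' (by positivity)] at this
  have hy0 : 0 < y := lt_of_lt_of_le (by positivity) (le_max_right _ _)
  refine ⟨b + y, by linarith, ?_⟩
  cases μ with
  | zero =>
    rw [negX1_zero hα hβ, ← hbdef, add_sub_cancel_left]
    linarith
  | succ m =>
    have ht : 1 ≤ b + y := (one_lt_of_lt hα hαβ (by linarith)).le
    have h1 := jacobiP_pos hα hβ ht (m + 1)
    have h0 := jacobiP_pos hα hβ ht m
    rw [negX1_succ hα hβ, ← hbdef, add_sub_cancel_left]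
    have : 0 ≤ (m : ℝ) * y := by positivity
    have : 0 < (2 * m + 2 + α + β) * y / 2 - b := by linarith
    positivity

lemma negX1_eq_zero_iff {α β : ℝ} (hα : 0 < α) (hβ : 0 < β) (μ : ℕ) (x : ℝ) :
    negX1 α β μ x = 0 ↔ X1jacobiP α β (μ + 1) x = 0 := by
  have : -(2 * (μ : ℝ) + α + β) ≠ 0 := neg_ne_zero.mpr (by positivity)
  rw [negX1, mul_eq_zero, or_iff_right this]

lemma continuous_negX1 (α β : ℝ) (μ : ℕ) : Continuous (negX1 α β μ) := by
  have h1 := continuous_jacobiP α β (μ + 1 - 1)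
  have h2 := continuous_jacobiP α β (μ + 1 - 2)
  unfold negX1 X1jacobiP
  split_ifs <;> fun_prop

lemma EnumZeros.last_isGreatest {f : ℝ → ℝ} {n : ℕ} {z : ℕ → ℝ} (h : EnumZeros f n z)
    (hn : 1 ≤ n) : IsGreatest {x | f x = 0} (z n) := by
  refine ⟨(h.2 _).mpr ⟨n, hn, le_rfl, rfl⟩, fun x hx => ?_⟩
  obtain ⟨k, hk1, hkn, rfl⟩ := (h.2 x).mp hx
  exact h.1.monotoneOn ⟨hk1, hkn⟩ ⟨hn, le_rfl⟩ hkn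

/-- Any point where `negX1` is nonpositive lies weakly to the left of its greatest zero. -/
lemma le_greatest_zero_of_negX1_nonpos {α β Z x : ℝ} (hα : 0 < α) (hαβ : α < β) {μ : ℕ}
    (hZ : IsGreatest {x | X1jacobiP α β (μ + 1) x = 0} Z) (hx : negX1 α β μ x ≤ 0) : x ≤ Z := by
  obtain ⟨t, hxt, ht⟩ := negX1_eventually_pos hα hαβ μ x
  obtain ⟨w, hw, hw0⟩ := intermediate_value_Icc hxt (continuous_negX1 α β μ).continuousOn
    ⟨hx, ht.le⟩
  exact hw.1.trans (hZ.2 ((negX1_eq_zero_iff hα (hα.trans hαβ) μ w).mp hw0))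

/-- The greatest zero lies to the right of `b`, and beyond the threshold of `negX1_nonpos`. -/
lemma greatest_zero_lower_bound {α β Z : ℝ} (hα : 0 < α) (hαβ : α < β) {μ : ℕ}
    (hZ : IsGreatest {x | X1jacobiP α β (μ + 1) x = 0} Z) :
    (β + α) / (β - α) < Z ∧ 4 * α * β / (β - α) ^ 2 ≤
      ((2 * (μ : ℝ) + α + β) ^ 2 - (β - α) ^ 2) * ((Z - (β + α) / (β - α)) / 2) ^ 2 := by
  have hβ : 0 < β := hα.trans hαβ
  have hd : 0 < β - α := sub_pos.mpr hαβ
  have hM := sq_diff_pos hα hβ μ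
  set M := (2 * (μ : ℝ) + α + β) ^ 2 - (β - α) ^ 2 with hMdef
  have hT : 0 < 4 * α * β / (β - α) ^ 2 / M := by positivity
  set r := √(4 * α * β / (β - α) ^ 2 / M) with hr
  have hr0 : 0 < r := Real.sqrt_pos.mpr hT
  have hr2 : M * r ^ 2 = 4 * α * β / (β - α) ^ 2 := by
    rw [hr, Real.sq_sqrt hT.le]
    field_simp
  have hle : (β + α) / (β - α) + 2 * r ≤ Z := by
    refine le_greatest_zero_of_negX1_nonpos hα hαβ hZ
      (negX1_nonpos hα hαβ (by linarith) μ ?_)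
    rw [← hMdef, ← hr2]
    apply le_of_eq
    ring
  refine ⟨by linarith, ?_⟩
  rw [← hr2]
  gcongr
  linarith

/-- For `0 < α < β`, the exceptional zeros of the X₁-Jacobi polynomials
satisfy `x̂_{1,1} = c` and form a strictly decreasing sequence bounded below by `b`. -/
theorem X1jacobi_exceptional_zeros_strict_decreasing
    (α β : ℝ) (hα : 0 < α) (hαβ : α < β)
    (b c : ℝ) (hb : b = (β + α) / (β - α)) (hc : c = b + 2 / (β - α))
    (z : ℕ → ℕ → ℝ)
    (hz : ∀ n : ℕ, 1 ≤ n → EnumZeros (X1jacobiP α β n) n (z n)) :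
    z 1 1 = c ∧
      ∀ n : ℕ, 1 ≤ n → b < z (n + 1) (n + 1) ∧ z (n + 1) (n + 1) < z n n := by
  have hβ : 0 < β := hα.trans hαβ
  have hd : 0 < β - α := sub_pos.mpr hαβ
  subst hb
  have hmax (μ : ℕ) : IsGreatest {x | X1jacobiP α β (μ + 1) x = 0} (z (μ + 1) (μ + 1)) :=
    (hz (μ + 1) (by omega)).last_isGreatest (by omega)
  constructor
  · have h := (negX1_eq_zero_iff hα hβ 0 _).mpr (hmax 0).1
    rw [negX1_zero hα hβ, zero_add] at h
    have hs : α + β ≠ 0 := by positivity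
    have hy : z 1 1 - (β + α) / (β - α) = 2 / (β - α) := by
      apply mul_left_cancel₀ hs
      linear_combination 2 * h
    rw [hc]
    linarith
  · intro n hn
    obtain ⟨μ, rfl⟩ : ∃ μ, n = μ + 1 := ⟨n - 1, by omega⟩
    have hlow := (greatest_zero_lower_bound hα hαβ (hmax (μ + 1))).1
    refine ⟨hlow, ?_⟩
    by_contra! hle
    obtain ⟨hX, hXT⟩ := greatest_zero_lower_bound hα hαβ (hmax μ)
    have hzero := (negX1_eq_zero_iff hα hβ (μ + 1) _).mpr (hmax (μ + 1)).1
    have hM := sq_diff_pos hα hβ μ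
    refine (negX1_succ_pos hα hαβ hlow μ (hXT.trans ?_) ?_).ne' hzero
    · have := sub_pos.mpr hX
      gcongr
    · by_contra! hneg
      have heq := hle.antisymm (le_greatest_zero_of_negX1_nonpos hα hαβ (hmax μ) hneg.le)
      rw [← heq] at hneg
      exact hneg.ne ((negX1_eq_zero_iff hα hβ μ _).mpr (hmax μ).1)
end

section
/- Let n ≥ 2 and 2 ≤ k ≤ n. Then the k-th regular zero of the X₁-Laguerre polynomial is a strictly increasing function of the parameter: if 0 < α₁ < α₂ then x̂_{n,k}^{(α₁)} < x̂_{n,k}^{(α₂)}. -/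
open Finset Filter

open Polynomial in
/-- The generalized Laguerre polynomial as an element of `ℝ[X]`. -/
noncomputable def laguerrePoly (α : ℝ) (m : ℕ) : ℝ[X] :=
  ∑ k ∈ Finset.range (m + 1),
    C ((-1 : ℝ) ^ k / (Nat.factorial k : ℝ) *
      ((∏ j ∈ Finset.Icc (k + 1) m, (α + (j : ℝ))) / (Nat.factorial (m - k) : ℝ))) * X ^ k

namespace laguerrePoly

open Polynomial

theorem eval_eq (α : ℝ) (m : ℕ) (x : ℝ) : (laguerrePoly α m).eval x = laguerreL α m x := by
  simp [laguerrePoly, laguerreL, eval_finsetSum]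

theorem coeff_eq (α : ℝ) (m k : ℕ) : (laguerrePoly α m).coeff k =
    if k ≤ m then (-1 : ℝ) ^ k / (Nat.factorial k : ℝ) *
      ((∏ j ∈ Finset.Icc (k + 1) m, (α + (j : ℝ))) / (Nat.factorial (m - k) : ℝ)) else 0 := by
  simp only [laguerrePoly, finsetSum_coeff, coeff_C_mul_X_pow]
  rw [Finset.sum_ite_eq]
  simp

theorem natDegree_le (α : ℝ) (m : ℕ) : (laguerrePoly α m).natDegree ≤ m := by
  rw [natDegree_le_iff_coeff_eq_zero]
  intro k hk
  rw [coeff_eq, if_neg (by omega)]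

theorem coeff_succ (α : ℝ) (m k : ℕ) :
    ((k : ℝ) + 1) * (α + k + 1) * (laguerrePoly α m).coeff (k + 1) =
      -((m : ℝ) - k) * (laguerrePoly α m).coeff k := by
  rw [coeff_eq, coeff_eq]
  rcases lt_trichotomy k m with h | h | h
  · obtain ⟨d, rfl⟩ : ∃ d, m = k + 1 + d := ⟨m - (k + 1), by omega⟩
    rw [if_pos (by omega), if_pos (by omega),
      ← Finset.mul_prod_Ioc_eq_prod_Icc (show k + 1 ≤ k + 1 + d by omega),
      ← Finset.Icc_add_one_left_eq_Ioc,
      show k + 1 + d - (k + 1) = d by omega, show k + 1 + d - k = d + 1 by omega,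
      Nat.factorial_succ, Nat.factorial_succ]
    push_cast
    field_simp
    ring
  · subst h
    simp
  · rw [if_neg (by omega), if_neg (by omega)]
    simp

theorem coeff_pred (α : ℝ) (m k : ℕ) :
    ((m : ℝ) + 1 + α) * (laguerrePoly α m).coeff k =
      ((m : ℝ) + 1 - k) * (laguerrePoly α (m + 1)).coeff k := by
  rw [coeff_eq, coeff_eq]
  rcases lt_trichotomy k (m + 1) with h | h | h
  · obtain ⟨d, rfl⟩ : ∃ d, m = k + d := ⟨m - k, by omega⟩
    rw [if_pos (by omega), if_pos (by omega), Finset.prod_Icc_succ_top (by omega),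
      show k + d + 1 - k = d + 1 by omega, show k + d - k = d by omega, Nat.factorial_succ]
    push_cast
    field_simp
    ring
  · subst h
    simp
  · rw [if_neg (by omega), if_neg (by omega)]
    simp

theorem derivative_succ (α : ℝ) (m : ℕ) :
    derivative (laguerrePoly α (m + 1)) = -laguerrePoly (α + 1) m := by
  ext k
  rw [coeff_derivative, coeff_neg, coeff_eq, coeff_eq]
  by_cases h : k ≤ m
  · rw [if_pos h, if_pos (by omega), ← Finset.map_add_right_Icc (k + 1) m 1, Finset.prod_map,
      show m + 1 - (k + 1) = m - k by omega, Nat.factorial_succ]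
    have : ∀ j : ℕ, α + ((addRightEmbedding 1 j : ℕ) : ℝ) = α + 1 + j := by
      intro j
      simp
      ring
    simp only [this]
    push_cast
    field_simp
    ring
  · rw [if_neg h, if_neg (by omega)]
    simp

theorem differential_equation (α : ℝ) (m : ℕ) :
    X * derivative (derivative (laguerrePoly α m)) +
      (C (α + 1) - X) * derivative (laguerrePoly α m) + C (m : ℝ) * laguerrePoly α m = 0 := by
  ext k
  have h := coeff_succ α m k
  rcases k with _ | k
  · simp [sub_mul, coeff_derivative] at h ⊢
    linarith
  · simp only [sub_mul, coeff_add, coeff_sub, coeff_X_mul, coeff_C_mul, coeff_derivative,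
      coeff_zero]
    push_cast at h ⊢
    linear_combination h

theorem X_mul_derivative_succ (α : ℝ) (m : ℕ) :
    X * derivative (laguerrePoly α (m + 1)) =
      C ((m : ℝ) + 1) * laguerrePoly α (m + 1) - C ((m : ℝ) + 1 + α) * laguerrePoly α m := by
  ext k
  have h := coeff_pred α m k
  rcases k with _ | k
  · rw [coeff_sub, coeff_C_mul, coeff_C_mul, coeff_X_mul_zero]
    simp at h ⊢
    linarith
  · simp only [coeff_sub, coeff_X_mul, coeff_C_mul, coeff_derivative]
    push_cast at h ⊢
    linear_combination h

theorem succ_eq (α : ℝ) (m : ℕ) :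
    C ((m : ℝ) + 1) * laguerrePoly α (m + 1) =
      X * derivative (laguerrePoly (α + 1) m) + (C (α + 1) - X) * laguerrePoly (α + 1) m := by
  have h := differential_equation α (m + 1)
  rw [derivative_succ, derivative_neg] at h
  push_cast at h
  simp only [map_add, map_one] at h ⊢
  linear_combination h

end laguerrePoly

section RootProduct

open Polynomial

theorem eval_prod_sub (S : Finset ℕ) (ξ : ℕ → ℝ) (x : ℝ) :
    (∏ i ∈ S, (C (ξ i) - X)).eval x = ∏ i ∈ S, (ξ i - x) := by
  simp [eval_prod]

theorem eval_derivative_prod_sub (S : Finset ℕ) (ξ : ℕ → ℝ) (x : ℝ) (hx : ∀ i ∈ S, x ≠ ξ i) :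
    (derivative (∏ i ∈ S, (C (ξ i) - X))).eval x =
      (∏ i ∈ S, (ξ i - x)) * ∑ i ∈ S, 1 / (x - ξ i) := by
  induction S using Finset.induction_on with
  | empty => simp
  | insert a S ha ih =>
    have hxa : x - ξ a ≠ 0 := sub_ne_zero.2 (hx a (Finset.mem_insert_self a S))
    have := ih fun i hi => hx i (Finset.mem_insert_of_mem hi)
    rw [Finset.prod_insert ha, Finset.prod_insert ha, Finset.sum_insert ha, derivative_mul,
      eval_add, eval_mul, eval_mul, this, eval_prod_sub]
    simp
    field_simp
    ring

theorem eval_derivative_prod_sub_self {S : Finset ℕ} {a : ℕ} (ha : a ∈ S) (ξ : ℕ → ℝ) :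
    (derivative (∏ i ∈ S, (C (ξ i) - X))).eval (ξ a) = -∏ i ∈ S.erase a, (ξ i - ξ a) := by
  rw [← Finset.mul_prod_erase S _ ha, derivative_mul]
  simp [eval_prod]

theorem eval_derivative_derivative_prod_sub_self {S : Finset ℕ} {a : ℕ} (ha : a ∈ S)
    (ξ : ℕ → ℝ) (hξ : ∀ i ∈ S.erase a, ξ a ≠ ξ i) :
    (derivative (derivative (∏ i ∈ S, (C (ξ i) - X)))).eval (ξ a) =
      -2 * ((∏ i ∈ S.erase a, (ξ i - ξ a)) * ∑ i ∈ S.erase a, 1 / (ξ a - ξ i)) := by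
  rw [← eval_derivative_prod_sub _ _ _ hξ, ← Finset.mul_prod_erase S _ ha, derivative_mul]
  simp
  ring

theorem neg_one_pow_mul_prod_sub_pos {m j : ℕ} (hj : j ≤ m) {ξ : ℕ → ℝ} {x : ℝ}
    (hlt : ∀ i < j, ξ i < x) (hgt : ∀ i < m, j ≤ i → x < ξ i) :
    0 < (-1) ^ j * ∏ i ∈ Finset.range m, (ξ i - x) := by
  rw [← Finset.prod_range_mul_prod_Ico _ hj, ← mul_assoc]
  refine mul_pos ?_ (Finset.prod_pos fun i hi => ?_)
  · have : (-1 : ℝ) ^ j = ∏ i ∈ Finset.range j, (-1 : ℝ) := by simp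
    rw [this, ← Finset.prod_mul_distrib]
    refine Finset.prod_pos fun i hi => ?_
    linarith [hlt i (Finset.mem_range.1 hi)]
  · rw [Finset.mem_Ico] at hi
    linarith [hgt i hi.2 hi.1]

theorem neg_one_pow_mul_prod_erase_sub_pos {m j : ℕ} (hj : j < m) {ξ : ℕ → ℝ}
    (hξ : StrictMonoOn ξ (Set.Iio m)) :
    0 < (-1) ^ j * ∏ i ∈ (Finset.range m).erase j, (ξ i - ξ j) := by
  have hS : (Finset.range m).erase j = Finset.range j ∪ Finset.Ico (j + 1) m := by
    ext i
    simp
    omega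
  have hd : Disjoint (Finset.range j) (Finset.Ico (j + 1) m) := by
    rw [Finset.disjoint_left]
    intro i
    simp
    omega
  rw [hS, Finset.prod_union hd, ← mul_assoc]
  refine mul_pos ?_ (Finset.prod_pos fun i hi => ?_)
  · have : (-1 : ℝ) ^ j = ∏ i ∈ Finset.range j, (-1 : ℝ) := by simp
    rw [this, ← Finset.prod_mul_distrib]
    refine Finset.prod_pos fun i hi => ?_
    have hij := Finset.mem_range.1 hi
    linarith [hξ (show i ∈ Set.Iio m from hij.trans hj) (show j ∈ Set.Iio m from hj) hij]
  · rw [Finset.mem_Ico] at hi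
    linarith [hξ (show j ∈ Set.Iio m from hj) (show i ∈ Set.Iio m from hi.2) (by omega)]

end RootProduct

/-- A continuous function alternating in sign at `t 0 < t 1 < …` vanishes between them. -/
theorem exists_zero_between {f : ℝ → ℝ} (hf : Continuous f) {t : ℕ → ℝ} {m : ℕ}
    (ht : ∀ i < m, t i < t (i + 1)) (hs : ∀ i ≤ m, 0 < (-1) ^ i * f (t i)) :
    ∃ ξ : ℕ → ℝ, ∀ i < m, t i < ξ i ∧ ξ i < t (i + 1) ∧ f (ξ i) = 0 := by
  have : ∀ i, ∃ y, i < m → t i < y ∧ y < t (i + 1) ∧ f y = 0 := by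
    intro i
    by_cases hi : i < m
    · have h0 := hs i hi.le
      have h1 := hs (i + 1) hi
      have hg : ContinuousOn (fun x => -((-1 : ℝ) ^ i * f x)) (Set.Icc (t i) (t (i + 1))) := by
        fun_prop
      have h2 : (0 : ℝ) ∈ Set.Ioo (-((-1 : ℝ) ^ i * f (t i))) (-((-1 : ℝ) ^ i * f (t (i + 1)))) := by
        rw [pow_succ] at h1
        constructor <;> linarith
      obtain ⟨y, hy, hy0⟩ := intermediate_value_Ioo (ht i hi).le hg h2
      exact ⟨y, fun _ => ⟨hy.1, hy.2, by simpa using hy0⟩⟩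
    · exact ⟨0, fun h => absurd h hi⟩
  choose ξ hξ using this
  exact ⟨ξ, hξ⟩

theorem strictMonoOn_Iio_of_lt_succ {ξ : ℕ → ℝ} {m : ℕ}
    (h : ∀ i, i + 1 < m → ξ i < ξ (i + 1)) : StrictMonoOn ξ (Set.Iio m) := by
  intro i _ j hj hij
  induction j, hij using Nat.le_induction with
  | base => exact h i hj
  | succ j hij ih => exact (ih ((Nat.lt_succ_self j).trans hj)).trans (h j hj)

/-- If `f` has exactly `n` zeros and alternates in sign at `t 0 < … < t n`, its zeros are separated
by these points. -/
theorem EnumZeros.mem_Ioo {f : ℝ → ℝ} (hf : Continuous f) {n : ℕ} {z : ℕ → ℝ}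
    (hz : EnumZeros f n z) {t : ℕ → ℝ} (ht : ∀ i < n, t i < t (i + 1))
    (hs : ∀ i ≤ n, 0 < (-1) ^ i * f (t i)) {i : ℕ} (hi : i < n) :
    t i < z (i + 1) ∧ z (i + 1) < t (i + 1) := by
  obtain ⟨w, hw⟩ := exists_zero_between hf ht hs
  have hwm : StrictMonoOn w (Set.Iio n) := strictMonoOn_Iio_of_lt_succ fun i hi =>
    (hw i (by omega)).2.1.trans (hw (i + 1) hi).1
  have hk : ∀ i : Fin n, ∃ k : Fin n, w i = z (k + 1) := by
    intro i
    obtain ⟨k, hk1, hkn, hk⟩ := (hz.2 (w i)).1 (hw i i.2).2.2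
    exact ⟨⟨k - 1, by omega⟩, by rw [hk]; congr 1; simp; omega⟩
  choose σ hσ using hk
  have hσm : StrictMono σ := by
    intro a b hab
    by_contra! hba
    have h1 := hwm (show (a : ℕ) ∈ Set.Iio n from a.2) (show (b : ℕ) ∈ Set.Iio n from b.2) hab
    rw [hσ, hσ] at h1
    have h2 := hz.1.monotoneOn (show (σ b : ℕ) + 1 ∈ Set.Icc 1 n by simp)
      (show (σ a : ℕ) + 1 ∈ Set.Icc 1 n by simp) (by simpa using hba)
    linarith
  have hid : σ ⟨i, hi⟩ = ⟨i, hi⟩ := by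
    have := Finite.injective_iff_surjective.1 hσm.injective
    have h := Subsingleton.elim (hσm.orderIsoOfSurjective σ this) (OrderIso.refl _)
    exact DFunLike.congr_fun h ⟨i, hi⟩
  have := hσ ⟨i, hi⟩
  rw [hid] at this
  simp only at this
  rw [← this]
  exact ⟨(hw i hi).1, (hw i hi).2.1⟩

open Polynomial in
theorem eq_C_mul_prod_sub_of_eval_eq_zero {P : ℝ[X]} {m : ℕ} (hP : P.natDegree ≤ m) {ξ : ℕ → ℝ}
    (hξ : StrictMonoOn ξ (Set.Iio m)) (hpos : ∀ i < m, 0 < ξ i) (h0 : ∀ i < m, P.eval (ξ i) = 0) :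
    P = C (P.eval 0 / ∏ i ∈ Finset.range m, ξ i) * ∏ i ∈ Finset.range m, (C (ξ i) - X) := by
  set a := P.eval 0 / ∏ i ∈ Finset.range m, ξ i with ha
  have hprod : ∏ i ∈ Finset.range m, ξ i ≠ 0 :=
    (Finset.prod_pos fun i hi => hpos i (Finset.mem_range.1 hi)).ne'
  have hinj : Set.InjOn ξ (Finset.range m) := by
    simpa using hξ.injOn
  have hdeg : (C a * ∏ i ∈ Finset.range m, (C (ξ i) - X)).natDegree ≤ m := by
    refine (natDegree_C_mul_le _ _).trans ((natDegree_prod_le _ _).trans ?_)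
    refine (Finset.sum_le_card_nsmul _ _ 1 fun i _ => ?_).trans (by simp)
    compute_degree
  have hnot : (0 : ℝ) ∉ (Finset.range m).image ξ := by
    simp only [Finset.mem_image, Finset.mem_range, not_exists, not_and]
    intro i hi h
    exact (hpos i hi).ne' h
  rw [← sub_eq_zero]
  refine eq_zero_of_natDegree_lt_card_of_eval_eq_zero' _
    (insert 0 ((Finset.range m).image ξ)) ?_ ?_
  · intro x hx
    rw [eval_sub, eval_mul, eval_C, eval_prod_sub]
    rcases Finset.mem_insert.1 hx with rfl | hx
    · simp only [sub_zero, ha]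
      field_simp
      ring
    · obtain ⟨i, hi, rfl⟩ := Finset.mem_image.1 hx
      rw [h0 i (Finset.mem_range.1 hi), Finset.prod_eq_zero hi (sub_self _)]
      simp
  · rw [Finset.card_insert_of_notMem hnot, Finset.card_image_of_injOn hinj, Finset.card_range]
    exact Nat.lt_succ_of_le ((natDegree_sub_le _ _).trans (max_le hP hdeg))

/-- `P` is `c * ∏ i < m, (ξ i - X)` with `0 < c` and `0 < ξ 0 < … < ξ (m - 1)`. -/
structure HasPosRoots (P : Polynomial ℝ) (m : ℕ) (c : ℝ) (ξ : ℕ → ℝ) : Prop where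
  lead_pos : 0 < c
  strictMonoOn : StrictMonoOn ξ (Set.Iio m)
  root_pos : ∀ i < m, 0 < ξ i
  eq_prod : P = Polynomial.C c * ∏ i ∈ Finset.range m, (Polynomial.C (ξ i) - Polynomial.X)

namespace HasPosRoots

open Polynomial

variable {P : ℝ[X]} {m : ℕ} {c : ℝ} {ξ : ℕ → ℝ}

theorem eval_root (h : HasPosRoots P m c ξ) {i : ℕ} (hi : i < m) : P.eval (ξ i) = 0 := by
  rw [h.eq_prod, eval_mul, eval_prod_sub, Finset.prod_eq_zero (Finset.mem_range.2 hi) (sub_self _),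
    mul_zero]

theorem neg_one_pow_mul_eval_pos (h : HasPosRoots P m c ξ) {j : ℕ} (hj : j ≤ m) {x : ℝ}
    (hlt : ∀ i < j, ξ i < x) (hgt : ∀ i < m, j ≤ i → x < ξ i) : 0 < (-1) ^ j * P.eval x := by
  rw [h.eq_prod, eval_mul, eval_prod_sub, eval_C, mul_left_comm]
  exact mul_pos h.lead_pos (neg_one_pow_mul_prod_sub_pos hj hlt hgt)

theorem eval_pos_of_nonpos (h : HasPosRoots P m c ξ) {x : ℝ} (hx : x ≤ 0) : 0 < P.eval x := by
  simpa using h.neg_one_pow_mul_eval_pos (Nat.zero_le m) (x := x) (by simp)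
    fun i hi _ => hx.trans_lt (h.root_pos i hi)

theorem neg_one_pow_mul_eval_derivative_neg (h : HasPosRoots P m c ξ) {j : ℕ} (hj : j < m) :
    (-1) ^ j * (derivative P).eval (ξ j) < 0 := by
  rw [h.eq_prod, derivative_C_mul, eval_mul, eval_C,
    eval_derivative_prod_sub_self (Finset.mem_range.2 hj)]
  nlinarith [mul_pos h.lead_pos (neg_one_pow_mul_prod_erase_sub_pos hj h.strictMonoOn)]

theorem eval_derivative (h : HasPosRoots P m c ξ) {x : ℝ} (hx : ∀ i < m, x ≠ ξ i) :
    (derivative P).eval x = P.eval x * ∑ i ∈ Finset.range m, 1 / (x - ξ i) := by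
  rw [h.eq_prod, derivative_C_mul, eval_mul, eval_mul, eval_C, eval_prod_sub,
    eval_derivative_prod_sub _ _ _ fun i hi => hx i (Finset.mem_range.1 hi)]
  ring

end HasPosRoots

namespace laguerrePoly

open Polynomial

theorem exists_hasPosRoots (m : ℕ) : ∀ α : ℝ, 0 < α →
    ∃ c ξ, HasPosRoots (laguerrePoly α m) m c ξ := by
  induction m with
  | zero =>
    intro α _
    exact ⟨1, fun _ => 0, one_pos, fun i hi => absurd hi (Nat.not_lt_zero i),
      fun i hi => absurd hi (Nat.not_lt_zero i), by simp [laguerrePoly]⟩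
  | succ m ih =>
    intro α hα
    obtain ⟨c, ζ, hζ⟩ := ih (α + 1) (by linarith)
    have hm : (0 : ℝ) < (m : ℝ) + 1 := by positivity
    have heq : ∀ x, ((m : ℝ) + 1) * (laguerrePoly α (m + 1)).eval x =
        x * (derivative (laguerrePoly (α + 1) m)).eval x +
          (α + 1 - x) * (laguerrePoly (α + 1) m).eval x := by
      intro x
      simpa using congrArg (eval x) (succ_eq α m)
    -- a point to the right of all `ζ i` where the sign is that of the leading coefficient
    obtain ⟨T, hT0, hTζ, hTm⟩ : ∃ T : ℝ, 0 < T ∧ (∀ i < m, 2 * ζ i < T) ∧ 2 * m + α + 1 < T := by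
      have hnn : ∀ i ∈ Finset.range m, 0 ≤ 2 * ζ i := fun i hi => by
        linarith [hζ.root_pos i (Finset.mem_range.1 hi)]
      have hsum := Finset.sum_nonneg hnn
      have hm0 : (0 : ℝ) ≤ m := m.cast_nonneg
      refine ⟨∑ i ∈ Finset.range m, 2 * ζ i + (2 * m + α + 2), ?_, fun i hi => ?_, ?_⟩
      · linarith
      · linarith [Finset.single_le_sum hnn (Finset.mem_range.2 hi)]
      · linarith
    have hζT : ∀ i < m, ζ i < T := fun i hi => by linarith [hζ.root_pos i hi, hTζ i hi]
    have hsT : 0 < (-1) ^ (m + 1) * (laguerrePoly α (m + 1)).eval T := by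
      have h1 := hζ.neg_one_pow_mul_eval_pos le_rfl hζT fun i hi hmi => by omega
      have h2 : T * ∑ i ∈ Finset.range m, 1 / (T - ζ i) ≤ 2 * m := by
        rw [Finset.mul_sum]
        refine (Finset.sum_le_card_nsmul _ _ 2 fun i hi => ?_).trans (by simp [mul_comm])
        have hi := Finset.mem_range.1 hi
        rw [mul_one_div, div_le_iff₀ (by linarith [hζT i hi])]
        linarith [hTζ i hi]
      have h3 := heq T
      rw [hζ.eval_derivative fun i hi => (hζT i hi).ne'] at h3
      have h4 : ((m : ℝ) + 1) * ((-1) ^ (m + 1) * (laguerrePoly α (m + 1)).eval T) =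
          ((-1) ^ m * (laguerrePoly (α + 1) m).eval T) *
            (T - (α + 1) - T * ∑ i ∈ Finset.range m, 1 / (T - ζ i)) := by
        rw [pow_succ]
        linear_combination (-(-1) ^ m) * h3
      exact pos_of_mul_pos_right (h4 ▸ mul_pos h1 (by linarith)) hm.le
    have hsζ : ∀ i < m, 0 < (-1) ^ (i + 1) * (laguerrePoly α (m + 1)).eval (ζ i) := by
      intro i hi
      have h1 := hζ.neg_one_pow_mul_eval_derivative_neg hi
      have h2 := heq (ζ i)
      rw [hζ.eval_root hi, mul_zero, add_zero] at h2
      refine pos_of_mul_pos_right (a := (m : ℝ) + 1) ?_ hm.le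
      rw [mul_left_comm, h2, pow_succ]
      nlinarith [mul_pos (hζ.root_pos i hi) (neg_pos.2 h1)]
    have hs0 : 0 < (laguerrePoly α (m + 1)).eval 0 := by
      have h1 := hζ.eval_pos_of_nonpos le_rfl
      have h2 := heq 0
      refine pos_of_mul_pos_right (a := (m : ℝ) + 1) ?_ hm.le
      rw [h2]
      nlinarith
    let t : ℕ → ℝ := fun i => if i = 0 then 0 else if i ≤ m then ζ (i - 1) else T
    have ht0 : t 0 = 0 := rfl
    have htζ : ∀ i < m, t (i + 1) = ζ i := fun i hi => by simp [t, Nat.succ_le_of_lt hi]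
    have htT : t (m + 1) = T := by simp [t]
    have ht : ∀ i < m + 1, t i < t (i + 1) := by
      intro i hi
      rcases Nat.lt_succ_iff_lt_or_eq.1 hi with hi | rfl
      · rw [htζ i hi]
        rcases i with _ | i
        · exact hζ.root_pos 0 hi
        · rw [htζ i (by omega)]
          exact hζ.strictMonoOn (show i ∈ Set.Iio m by simp; omega) hi (Nat.lt_succ_self i)
      · rw [htT]
        rcases i with _ | i
        · exact hT0
        · rw [htζ i (by omega)]
          exact hζT i (by omega)
    have hs : ∀ i ≤ m + 1, 0 < (-1) ^ i * (fun x => (laguerrePoly α (m + 1)).eval x) (t i) := by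
      intro i hi
      rcases i with _ | i
      · simpa [ht0] using hs0
      · rcases Nat.lt_or_ge i m with him | him
        · simpa only [htζ i him] using hsζ i him
        · obtain rfl : i = m := by omega
          simpa only [htT] using hsT
    obtain ⟨ξ, hξ⟩ := exists_zero_between (laguerrePoly α (m + 1)).continuous ht hs
    have hmono : StrictMonoOn ξ (Set.Iio (m + 1)) := strictMonoOn_Iio_of_lt_succ fun i hi =>
      (hξ i (by omega)).2.1.trans (hξ (i + 1) hi).1
    have hpos : ∀ i < m + 1, 0 < ξ i := by
      intro i hi
      have h1 := (hξ 0 (by omega)).1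
      rw [ht0] at h1
      exact h1.trans_le (hmono.monotoneOn (show 0 ∈ Set.Iio (m + 1) by simp) hi (Nat.zero_le i))
    exact ⟨_, ξ, div_pos hs0 (Finset.prod_pos fun i hi => hpos i (Finset.mem_range.1 hi)), hmono,
      hpos, eq_C_mul_prod_sub_of_eval_eq_zero (natDegree_le α (m + 1)) hmono hpos
        fun i hi => (hξ i hi).2.2⟩

/-- The Stieltjes relations satisfied by the zeros of a Laguerre polynomial. -/
theorem stieltjes_relation {α : ℝ} {m : ℕ} {c : ℝ} {ξ : ℕ → ℝ}
    (h : HasPosRoots (laguerrePoly α m) m c ξ) {i : ℕ} (hi : i < m) :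
    2 * ∑ j ∈ (Finset.range m).erase i, ξ i / (ξ i - ξ j) = ξ i - (α + 1) := by
  have hne : ∀ j ∈ (Finset.range m).erase i, ξ i ≠ ξ j := by
    intro j hj heq
    rw [Finset.mem_erase, Finset.mem_range] at hj
    exact hj.1 (h.strictMonoOn.injOn hj.2 hi heq.symm)
  have hode := congrArg (eval (ξ i)) (differential_equation α m)
  simp only [eval_add, eval_mul, eval_sub, eval_X, eval_C, eval_zero, h.eval_root hi] at hode
  have hi' := Finset.mem_range.2 hi
  rw [h.eq_prod, derivative_C_mul, derivative_C_mul, eval_C_mul, eval_C_mul,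
    eval_derivative_prod_sub_self hi', eval_derivative_derivative_prod_sub_self hi' ξ hne] at hode
  have hq : ∏ j ∈ (Finset.range m).erase i, (ξ j - ξ i) ≠ 0 :=
    Finset.prod_ne_zero_iff.2 fun j hj => sub_ne_zero.2 (hne j hj).symm
  have hsum : ∑ j ∈ (Finset.range m).erase i, ξ i / (ξ i - ξ j) =
      ξ i * ∑ j ∈ (Finset.range m).erase i, 1 / (ξ i - ξ j) := by
    simp only [Finset.mul_sum, mul_one_div]
  rw [hsum]
  refine mul_left_cancel₀ (mul_ne_zero h.lead_pos.ne' hq) ?_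
  linear_combination -hode

end laguerrePoly

theorem div_sub_le_div_sub {a b c d : ℝ} (h : 0 < (a - b) * (c - d)) (hbd : b * c ≤ d * a) :
    a / (a - b) ≤ c / (c - d) := by
  have h1 : a - b ≠ 0 := left_ne_zero_of_mul h.ne'
  have h2 : c - d ≠ 0 := right_ne_zero_of_mul h.ne'
  have h3 : c / (c - d) - a / (a - b) = (d * a - b * c) / ((a - b) * (c - d)) := by
    field_simp
    ring
  have h4 : 0 ≤ (d * a - b * c) / ((a - b) * (c - d)) := div_nonneg (by linarith) h.le
  linarith

/-- The zeros of the Laguerre polynomials increase with the parameter: compare the Stieltjes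
relations at an index where the ratio of the zeros is maximal. -/
theorem laguerrePoly.root_lt_root {α β : ℝ} (hαβ : α < β) {m : ℕ} {c d : ℝ} {ξ η : ℕ → ℝ}
    (hξ : HasPosRoots (laguerrePoly α m) m c ξ) (hη : HasPosRoots (laguerrePoly β m) m d η)
    {i : ℕ} (hi : i < m) : ξ i < η i := by
  obtain ⟨k, hk, hmax⟩ := Finset.exists_max_image (Finset.range m) (fun j => ξ j / η j)
    ⟨i, Finset.mem_range.2 hi⟩
  have hkm := Finset.mem_range.1 hk
  have hle : ∑ j ∈ (Finset.range m).erase k, ξ k / (ξ k - ξ j) ≤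
      ∑ j ∈ (Finset.range m).erase k, η k / (η k - η j) := by
    refine Finset.sum_le_sum fun j hj => ?_
    have hjm := Finset.mem_range.1 (Finset.mem_of_mem_erase hj)
    refine div_sub_le_div_sub ?_ ?_
    · rcases lt_or_gt_of_ne (Finset.ne_of_mem_erase hj) with hjk | hjk
      · exact mul_pos (sub_pos.2 (hξ.strictMonoOn hjm hkm hjk))
          (sub_pos.2 (hη.strictMonoOn hjm hkm hjk))
      · exact mul_pos_of_neg_of_neg (sub_neg.2 (hξ.strictMonoOn hkm hjm hjk))
          (sub_neg.2 (hη.strictMonoOn hkm hjm hjk))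
    · have := hmax j (Finset.mem_of_mem_erase hj)
      rw [div_le_div_iff₀ (hη.root_pos j hjm) (hη.root_pos k hkm)] at this
      linarith
  have hlt : ξ k < η k := by
    linarith [laguerrePoly.stieltjes_relation hξ hkm, laguerrePoly.stieltjes_relation hη hkm]
  have h1 := hmax i (Finset.mem_range.2 hi)
  have h2 : ξ k / η k < 1 := (div_lt_one (hη.root_pos k hkm)).2 hlt
  exact (div_lt_one (hη.root_pos i hi)).1 (h1.trans_lt h2)

theorem continuous_X1laguerreL (α : ℝ) (n : ℕ) : Continuous (X1laguerreL α n) := by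
  unfold X1laguerreL laguerreL
  split_ifs <;> fun_prop

theorem mul_X1laguerreL (α : ℝ) (r : ℕ) (x : ℝ) :
    ((r : ℝ) + 1 + α) * X1laguerreL α (r + 2) x =
      -(((r : ℝ) + 1 + α) * (x + α) + α) * (laguerrePoly α (r + 1)).eval x -
        x * (laguerrePoly α (r + 1)).derivative.eval x := by
  have h := congrArg (Polynomial.eval x) (laguerrePoly.X_mul_derivative_succ α r)
  simp only [Polynomial.eval_sub, Polynomial.eval_mul, Polynomial.eval_X, Polynomial.eval_C] at h
  rw [h, X1laguerreL, if_pos (by omega), ← laguerrePoly.eval_eq, ← laguerrePoly.eval_eq]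
  simp only [Nat.add_sub_cancel, show r + 2 - 1 = r + 1 by omega]
  ring

theorem neg_one_pow_mul_X1laguerreL_root_pos {α : ℝ} (hα : 0 < α) {r : ℕ} {c : ℝ} {ξ : ℕ → ℝ}
    (hξ : HasPosRoots (laguerrePoly α (r + 1)) (r + 1) c ξ) {i : ℕ} (hi : i < r + 1) :
    0 < (-1) ^ i * X1laguerreL α (r + 2) (ξ i) := by
  have h1 := mul_X1laguerreL α r (ξ i)
  rw [hξ.eval_root hi, mul_zero, zero_sub] at h1
  have h2 := hξ.neg_one_pow_mul_eval_derivative_neg hi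
  refine pos_of_mul_pos_right (a := (r : ℝ) + 1 + α) ?_ (by positivity)
  rw [mul_left_comm, h1]
  nlinarith [mul_pos (hξ.root_pos i hi) (neg_pos.2 h2)]

/-- The points separating the zeros of `X1laguerreL α (r + 2)`, built from the zeros `ξ` of the
Laguerre polynomial of degree `r + 1`. -/
noncomputable def separatingPoint (α : ℝ) (ξ : ℕ → ℝ) : ℕ → ℝ
  | 0 => -(α + 2)
  | 1 => 0
  | i + 2 => ξ i

theorem mem_Ioo_separatingPoint {α : ℝ} (hα : 0 < α) {r : ℕ} {c : ℝ} {ξ z : ℕ → ℝ}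
    (hξ : HasPosRoots (laguerrePoly α (r + 1)) (r + 1) c ξ)
    (hz : EnumZeros (X1laguerreL α (r + 2)) (r + 2) z) {i : ℕ} (hi : i < r + 2) :
    separatingPoint α ξ i < z (i + 1) ∧ z (i + 1) < separatingPoint α ξ (i + 1) := by
  refine hz.mem_Ioo (continuous_X1laguerreL α _) (fun i hi => ?_) (fun i hi => ?_) hi
  · rcases i with _ | _ | i
    · simp only [separatingPoint]
      linarith
    · exact hξ.root_pos 0 (by omega)
    · exact hξ.strictMonoOn (show i ∈ Set.Iio (r + 1) by simp; omega)
        (show i + 1 ∈ Set.Iio (r + 1) by simp; omega) (Nat.lt_succ_self i)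
  · rcases i with _ | _ | i
    · obtain ⟨d, ζ, hζ⟩ := laguerrePoly.exists_hasPosRoots r α hα
      have h1 := hξ.eval_pos_of_nonpos (show -(α + 2) ≤ 0 by linarith)
      have h2 := hζ.eval_pos_of_nonpos (show -(α + 2) ≤ 0 by linarith)
      rw [laguerrePoly.eval_eq] at h1 h2
      simp only [separatingPoint, X1laguerreL, show 2 ≤ r + 2 by omega, if_true,
        Nat.add_sub_cancel, show r + 2 - 1 = r + 1 by omega]
      linarith
    · have h1 := hξ.eval_pos_of_nonpos le_rfl
      have h2 := mul_X1laguerreL α r 0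
      refine pos_of_mul_pos_right (a := (r : ℝ) + 1 + α) ?_ (by positivity)
      have h3 : 0 < (((r : ℝ) + 1 + α) * (0 + α) + α) := by positivity
      simp only [separatingPoint]
      rw [mul_left_comm, h2, zero_add, pow_one]
      linarith [mul_pos h3 h1]
    · rw [add_assoc, pow_add]
      simpa [separatingPoint] using neg_one_pow_mul_X1laguerreL_root_pos hα hξ
        (show i < r + 1 by omega)

theorem X1laguerreL_regular_zero_lt {α β : ℝ} (hα : 0 < α) (hαβ : α < β) {r j : ℕ}
    (hj : j < r + 1) {z w : ℕ → ℝ} (hz : EnumZeros (X1laguerreL α (r + 2)) (r + 2) z)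
    (hw : EnumZeros (X1laguerreL β (r + 2)) (r + 2) w) : z (j + 2) < w (j + 2) := by
  have hβ := hα.trans hαβ
  obtain ⟨c, ξ, hξ⟩ := laguerrePoly.exists_hasPosRoots (r + 1) α hα
  obtain ⟨d, η, hη⟩ := laguerrePoly.exists_hasPosRoots (r + 1) β hβ
  have hξη : ∀ i < r + 1, ξ i < η i := fun i hi => laguerrePoly.root_lt_root hαβ hξ hη hi
  obtain ⟨hzl, hzr⟩ := mem_Ioo_separatingPoint hα hξ hz (show j + 1 < r + 2 by omega)
  have hwloc := fun i hi => mem_Ioo_separatingPoint hβ hη hw (i := i) hi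
  rcases le_or_gt (z (j + 2)) (separatingPoint β η (j + 1)) with hle | hlt
  · exact hle.trans_lt (hwloc (j + 1) (by omega)).1
  set x := z (j + 2)
  change x < ξ j at hzr
  have hx0 : 0 < x := by
    rcases j with _ | j
    · exact hzl
    · exact (hξ.root_pos j (by omega)).trans hzl
  have hη_lt : ∀ i < j, η i < x := by
    intro i hi
    rcases j with _ | j
    · omega
    · exact (hη.strictMonoOn.monotoneOn (show i ∈ Set.Iio (r + 1) by simp; omega)
        (show j ∈ Set.Iio (r + 1) by simp; omega) (by omega)).trans_lt hlt
  have hξ_gt : ∀ i < r + 1, j ≤ i → x < ξ i := fun i hi hji =>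
    hzr.trans_le (hξ.strictMonoOn.monotoneOn hj hi hji)
  have hξ_lt : ∀ i < j, ξ i < x := fun i hi => (hξη i (by omega)).trans (hη_lt i hi)
  have hη_gt : ∀ i < r + 1, j ≤ i → x < η i := fun i hi hji => (hξ_gt i hi hji).trans (hξη i hi)
  have hξ_ne : ∀ i < r + 1, x ≠ ξ i := fun i hi => by
    rcases lt_or_ge i j with h | h
    exacts [(hξ_lt i h).ne', (hξ_gt i hi h).ne]
  have hη_ne : ∀ i < r + 1, x ≠ η i := fun i hi => by
    rcases lt_or_ge i j with h | h
    exacts [(hη_lt i h).ne', (hη_gt i hi h).ne]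
  have hsum : x * ∑ i ∈ Finset.range (r + 1), 1 / (x - ξ i) ≤
      x * ∑ i ∈ Finset.range (r + 1), 1 / (x - η i) := by
    simp only [Finset.mul_sum, mul_one_div]
    refine Finset.sum_le_sum fun i hi => ?_
    have hi := Finset.mem_range.1 hi
    refine div_sub_le_div_sub ?_ (by nlinarith [hξη i hi])
    rcases lt_or_ge i j with h | h
    · exact mul_pos (sub_pos.2 (hξ_lt i h)) (sub_pos.2 (hη_lt i h))
    · exact mul_pos_of_neg_of_neg (sub_neg.2 (hξ_gt i hi h)) (sub_neg.2 (hη_gt i hi h))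
  have hzero : ((r : ℝ) + 1 + α) * (x + α) + α +
      x * ∑ i ∈ Finset.range (r + 1), 1 / (x - ξ i) = 0 := by
    have h1 := mul_X1laguerreL α r x
    rw [(hz.2 x).2 ⟨j + 2, by omega, by omega, rfl⟩, hξ.eval_derivative hξ_ne] at h1
    have h2 := hξ.neg_one_pow_mul_eval_pos hj.le hξ_lt hξ_gt
    refine mul_left_cancel₀ (right_ne_zero_of_mul h2.ne') ?_
    linear_combination h1
  have hr : (0 : ℝ) ≤ r := r.cast_nonneg
  have hpos : 0 < ((r : ℝ) + 1 + β) * (x + β) + β +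
      x * ∑ i ∈ Finset.range (r + 1), 1 / (x - η i) := by
    nlinarith
  have hsx : (-1) ^ j * X1laguerreL β (r + 2) x < 0 := by
    have h1 := mul_X1laguerreL β r x
    rw [hη.eval_derivative hη_ne] at h1
    have h2 := mul_pos (hη.neg_one_pow_mul_eval_pos hj.le hη_lt hη_gt) hpos
    refine neg_of_mul_neg_right (a := (r : ℝ) + 1 + β) ?_ (by positivity)
    linear_combination h2 + (-1) ^ j * h1
  have hsη := neg_one_pow_mul_X1laguerreL_root_pos hβ hη hj
  have hcont : ContinuousOn (fun y => (-1) ^ j * X1laguerreL β (r + 2) y) (Set.Icc x (η j)) :=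
    (continuous_const.mul (continuous_X1laguerreL β _)).continuousOn
  obtain ⟨y, hy, hy0⟩ := intermediate_value_Ioo (hη_gt j hj le_rfl).le hcont ⟨hsx, hsη⟩
  obtain ⟨k, hk1, hkn, rfl⟩ := (hw.2 y).1 (by simpa using hy0)
  rcases le_or_gt k (j + 2) with hkj | hkj
  · exact hy.1.trans_le (hw.1.monotoneOn ⟨hk1, hkn⟩ ⟨by omega, by omega⟩ hkj)
  · have h1 := (hwloc (j + 2) (by omega)).1
    have h2 := hw.1.monotoneOn (show j + 3 ∈ Set.Icc 1 (r + 2) from ⟨by omega, by omega⟩)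
      ⟨hk1, hkn⟩ hkj
    exact absurd (h1.trans_le h2) (not_lt.2 hy.2.le)

/-- For `n ≥ 2` and `2 ≤ k ≤ n`, the `k`-th regular zero of the X₁-Laguerre
polynomial is a strictly increasing function of the parameter `α`. -/
theorem X1laguerre_regular_zeros_monotone_in_alpha
    (α₁ α₂ : ℝ) (h₁ : 0 < α₁) (h₁₂ : α₁ < α₂)
    (n k : ℕ) (hn : 2 ≤ n) (hk : 2 ≤ k) (hkn : k ≤ n)
    (z₁ z₂ : ℕ → ℝ)
    (hz₁ : EnumZeros (X1laguerreL α₁ n) n z₁)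
    (hz₂ : EnumZeros (X1laguerreL α₂ n) n z₂) :
    z₁ k < z₂ k := by
  obtain ⟨r, rfl⟩ : ∃ r, n = r + 2 := ⟨n - 2, by omega⟩
  obtain ⟨j, rfl⟩ : ∃ j, k = j + 2 := ⟨k - 2, by omega⟩
  exact X1laguerreL_regular_zero_lt h₁ h₁₂ (by omega) hz₁ hz₂
end
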